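/- Let κ > 0 and t > 0. Then for every v ∈ ℝ and every u ∈ ℝ with u ≠ 0, 2u ∂_u(log h_t^{(κ)}(·,v))(u) + log h_t^{(κ)}(−u,v) − log h_t^{(κ)}(u,v) ≥ −2 u² coth(2t); equivalently, (κ/u²)[2u ∂_u log h_t^{(κ)}(u,v) − log h_t^{(κ)}(u,v) + log h_t^{(κ)}(−u,v)] ≥ −2κ coth(2t). -/

import Mathlib

open Real MeasureTheory

/-- The one-dimensional kernel `h_t^{(κ)}(u,v)` of the Dunkl harmonic oscillator. -/
noncomputable def hKer (κ t u v : ℝ) : ℝ :=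
  ((2 : ℝ) ^ (κ + 1/2) * Real.sqrt π * Real.Gamma (κ + 1/2))⁻¹
    * Real.sinh (2*t) ^ (-(κ + 1/2))
    * Real.exp (-(1/2) * (Real.cosh (2*t) / Real.sinh (2*t)) * (u^2 + v^2))
    * ∫ s in (-1 : ℝ)..(1 : ℝ),
        (1 - s) ^ (κ - 1) * (1 + s) ^ κ * Real.exp (u * v * s / Real.sinh (2*t))

open ProbabilityTheory

/-- The logarithm of a moment generating function lies above its tangent lines. -/
lemma tangent_le_log_mgf {Ω : Type*} [MeasurableSpace Ω] {μ : Measure Ω} {X : Ω → ℝ}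
    (hμ : μ ≠ 0) (hexp : ∀ x : ℝ, Integrable (fun ω => Real.exp (x * X ω)) μ) (x y : ℝ) :
    Real.log (mgf X μ x) + (y - x) * (deriv (mgf X μ) x / mgf X μ x)
      ≤ Real.log (mgf X μ y) := by
  have hset : x ∈ interior (integrableExpSet X μ) := by
    have : integrableExpSet X μ = Set.univ := Set.eq_univ_of_forall hexp
    simp [this]
  have hx : 0 < mgf X μ x := mgf_pos' hμ (hexp x)
  have hy : 0 < mgf X μ y := mgf_pos' hμ (hexp y)
  have hint : Integrable (fun ω => X ω * Real.exp (x * X ω)) μ := by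
    simpa using integrable_pow_mul_exp_of_mem_interior_integrableExpSet hset 1
  rw [deriv_mgf hset]
  set m := (∫ ω, X ω * Real.exp (x * X ω) ∂μ) / mgf X μ x with hm
  have hmean : ∫ ω, X ω * Real.exp (x * X ω) ∂μ = m * mgf X μ x := by
    rw [hm, div_mul_cancel₀ _ hx.ne']
  have hle : Real.exp ((y - x) * m) * mgf X μ x ≤ mgf X μ y := by
    have hpt : ∀ ω, Real.exp ((y - x) * m) * ((1 - (y - x) * m) * Real.exp (x * X ω)
        + (y - x) * (X ω * Real.exp (x * X ω))) ≤ Real.exp (y * X ω) := by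
      intro ω
      have h1 := Real.add_one_le_exp ((y - x) * (X ω - m))
      have h2 : Real.exp (y * X ω)
          = Real.exp ((y - x) * m) * Real.exp (x * X ω) * Real.exp ((y - x) * (X ω - m)) := by
        rw [← Real.exp_add, ← Real.exp_add]; congr 1; ring
      rw [h2]
      have := mul_le_mul_of_nonneg_left h1
        (mul_pos (Real.exp_pos ((y - x) * m)) (Real.exp_pos (x * X ω))).le
      linarith
    have hadd := ((hexp x).const_mul (1 - (y - x) * m)).add (hint.const_mul (y - x))
    have hmono := integral_mono (hadd.const_mul (Real.exp ((y - x) * m))) (hexp y) hpt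
    simp only [Pi.add_apply] at hmono
    rw [integral_const_mul, integral_add ((hexp x).const_mul _) (hint.const_mul _),
      integral_const_mul, integral_const_mul, hmean] at hmono
    change Real.exp ((y - x) * m) * ((1 - (y - x) * m) * mgf X μ x + (y - x) * (m * mgf X μ x))
      ≤ mgf X μ y at hmono
    linarith
  have hlog := Real.log_le_log (mul_pos (Real.exp_pos _) hx) hle
  rw [Real.log_mul (Real.exp_pos _).ne' hx.ne', Real.log_exp] at hlog
  linarith

lemma intervalIntegrable_jacobi_weight {κ : ℝ} (hκ : 0 < κ) :
    IntervalIntegrable (fun s : ℝ => (1 - s) ^ (κ - 1) * (1 + s) ^ κ) volume (-1) 1 := by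
  have h : IntervalIntegrable (fun s : ℝ => (1 - s) ^ (κ - 1)) volume (-1) 1 := by
    have := (intervalIntegral.intervalIntegrable_rpow' (a := 2) (b := 0)
      (r := κ - 1) (by linarith)).comp_sub_left 1
    norm_num at this
    exact this
  refine h.mul_continuousOn (Continuous.continuousOn ?_)
  exact (continuous_const.add continuous_id).rpow_const fun _ => Or.inr hκ.le

/-- The Dunkl kernel of parameter `κ` is the moment generating function of a finite measure
supported in `[-1, 1]`. -/
lemma exists_measure_mgf_eq {κ : ℝ} (hκ : 0 < κ) :
    ∃ μ : Measure ℝ, μ ≠ 0 ∧ (∀ x : ℝ, Integrable (fun s => Real.exp (x * id s)) μ) ∧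
      ∀ x : ℝ, ∫ s in (-1 : ℝ)..1, (1 - s) ^ (κ - 1) * (1 + s) ^ κ * Real.exp (x * s)
        = mgf id μ x := by
  set w : ℝ → ℝ := fun s => (1 - s) ^ (κ - 1) * (1 + s) ^ κ with hw
  have hwm : Measurable w := by
    rw [hw]; fun_prop
  have hwi := intervalIntegrable_jacobi_weight hκ
  have hw0 : ∀ s ∈ Set.Ioc (-1 : ℝ) 1, 0 ≤ w s := fun s hs =>
    mul_nonneg (Real.rpow_nonneg (by linarith [hs.2]) _) (Real.rpow_nonneg (by linarith [hs.1]) _)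
  set ν := volume.restrict (Set.Ioc (-1 : ℝ) 1) with hν
  set μ := ν.withDensity (fun s => ENNReal.ofReal (w s)) with hμ
  have hfin : IsFiniteMeasure μ := by
    apply isFiniteMeasure_withDensity_ofReal
    exact ((intervalIntegrable_iff_integrableOn_Ioc_of_le (by norm_num)).1 hwi).2
  have hmgf : ∀ x : ℝ, ∫ s in (-1 : ℝ)..1, w s * Real.exp (x * s) = mgf id μ x := by
    intro x
    rw [mgf, integral_withDensity_eq_integral_toReal_smul (by fun_prop) (by simp),
      intervalIntegral.integral_of_le (by norm_num)]
    refine setIntegral_congr_fun measurableSet_Ioc fun s hs => ?_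
    simp [ENNReal.toReal_ofReal (hw0 s hs)]
  refine ⟨μ, ?_, ?_, hmgf⟩
  · intro h0
    have hpos : 0 < ∫ s in (-1 : ℝ)..1, w s :=
      intervalIntegral.intervalIntegral_pos_of_pos_on hwi (fun s hs =>
        mul_pos (Real.rpow_pos_of_pos (by linarith [hs.2]) _)
          (Real.rpow_pos_of_pos (by linarith [hs.1]) _)) (by norm_num)
    have h := hmgf 0
    simp [h0] at h
    exact hpos.ne' h
  · intro x
    refine integrable_exp_mul_of_mem_Icc (a := -1) (b := 1) aemeasurable_id ?_
    refine (withDensity_absolutelyContinuous ν _).ae_le ?_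
    filter_upwards [ae_restrict_mem measurableSet_Ioc] with s hs
    exact ⟨hs.1.le, hs.2⟩

/-- For `κ > 0`, `t > 0`, `v ∈ ℝ` and `u ≠ 0`:
`2u ∂_u log h_t^{(κ)}(u,v) + log h_t^{(κ)}(−u,v) − log h_t^{(κ)}(u,v) ≥ −2u² coth(2t)`;
equivalently, multiplying by `κ/u²`,
`(κ/u²)[2u ∂_u log h_t^{(κ)}(u,v) − log h_t^{(κ)}(u,v) + log h_t^{(κ)}(−u,v)]
  ≥ −2κ coth(2t)`. -/
theorem stmt19 (κ t : ℝ) (hκ : 0 < κ) (ht : 0 < t) (v u : ℝ) (hu : u ≠ 0) :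
    (-(2 * u ^ 2 * (Real.cosh (2*t) / Real.sinh (2*t)))
      ≤ 2 * u * deriv (fun w => Real.log (hKer κ t w v)) u
        + Real.log (hKer κ t (-u) v) - Real.log (hKer κ t u v))
    ∧ (-(2 * κ * (Real.cosh (2*t) / Real.sinh (2*t)))
      ≤ κ / u ^ 2 * (2 * u * deriv (fun w => Real.log (hKer κ t w v)) u
          - Real.log (hKer κ t u v) + Real.log (hKer κ t (-u) v))) := by
  obtain ⟨μ, hμ, hexp, hmgf⟩ := exists_measure_mgf_eq hκ
  have hpos : ∀ x, 0 < mgf id μ x := fun x => mgf_pos' hμ (hexp x)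
  have hsinh : 0 < Real.sinh (2 * t) := Real.sinh_pos_iff.2 (by linarith)
  set S := Real.sinh (2 * t) with hS
  set c := Real.cosh (2 * t) / S with hc
  set C := ((2 : ℝ) ^ (κ + 1/2) * Real.sqrt π * Real.Gamma (κ + 1/2))⁻¹ * S ^ (-(κ + 1/2))
    with hC
  have hC0 : 0 < C := by
    have := Real.Gamma_pos_of_pos (show 0 < κ + 1/2 by linarith)
    positivity
  have hlog : ∀ w, Real.log (hKer κ t w v)
      = Real.log C + -(1/2) * c * (w ^ 2 + v ^ 2) + Real.log (mgf id μ (w * v / S)) := by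
    intro w
    have hker : hKer κ t w v
        = C * Real.exp (-(1/2) * c * (w ^ 2 + v ^ 2)) * mgf id μ (w * v / S) := by
      rw [hKer, ← hmgf]
      simp only [← hS, ← hc, ← hC, div_mul_eq_mul_div]
    rw [hker, Real.log_mul (by positivity) (hpos _).ne', Real.log_mul hC0.ne' (by positivity),
      Real.log_exp]
  have hset : u * v / S ∈ interior (integrableExpSet id μ) := by
    have : integrableExpSet id μ = Set.univ := Set.eq_univ_of_forall hexp
    simp [this]
  have hderiv : deriv (fun w => Real.log (hKer κ t w v)) u
      = -c * u + v / S * (deriv (mgf id μ) (u * v / S) / mgf id μ (u * v / S)) := by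
    simp only [hlog]
    have hlin : HasDerivAt (fun w : ℝ => w * v / S) (v / S) u := by
      simpa using ((hasDerivAt_id u).mul_const v).div_const S
    have hM := (HasDerivAt.comp u (hasDerivAt_mgf hset).differentiableAt.hasDerivAt hlin).log
      (hpos (u * v / S)).ne'
    have hQ := (((hasDerivAt_pow 2 u).add_const (v ^ 2)).const_mul (-(1/2) * c)).const_add
      (Real.log C)
    refine ((hQ.add hM).deriv).trans ?_
    simp only [Function.comp_apply]
    push_cast
    ring
  have hmain : -(2 * u ^ 2 * c) ≤ 2 * u * deriv (fun w => Real.log (hKer κ t w v)) u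
      + Real.log (hKer κ t (-u) v) - Real.log (hKer κ t u v) := by
    have h := tangent_le_log_mgf hμ hexp (u * v / S) (-u * v / S)
    rw [hderiv, hlog, hlog]
    ring_nf at h ⊢
    linarith
  refine ⟨hmain, ?_⟩
  have h := mul_le_mul_of_nonneg_left hmain (show 0 ≤ κ / u ^ 2 by positivity)
  have he : κ / u ^ 2 * -(2 * u ^ 2 * c) = -(2 * κ * c) := by field_simp
  rw [he] at h
  linarith
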